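/- Let κ > 0 and set g(s) = (1−s)^{κ−1}(1+s)^{κ} for s ∈ (−1,1). Then the function ψ(a) := (∫_{−1}^1 s g(s) e^{as} ds)(∫_{−1}^1 g(s) e^{−as} ds) − (∫_{−1}^1 g(s) e^{as} ds)(∫_{−1}^1 s g(s) e^{−as} ds) is nondecreasing on ℝ; in particular ψ(a) ≥ 0 for a ≥ 0 and ψ(a) ≤ 0 for a ≤ 0. -/

import Mathlib

open Real MeasureTheory

/-- For a fixed `u`, the function `a ↦ u * exp (a * u)` is nondecreasing. -/
lemma monotone_mul_exp_mul (u : ℝ) : Monotone fun a : ℝ => u * Real.exp (a * u) := by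
  intro a b hab
  rcases le_total 0 u with hu | hu
  · exact mul_le_mul_of_nonneg_left
      (Real.exp_le_exp.2 (mul_le_mul_of_nonneg_right hab hu)) hu
  · exact mul_le_mul_of_nonpos_left
      (Real.exp_le_exp.2 (mul_le_mul_of_nonpos_right hab hu)) hu

/-- If `g ≥ 0` and the exponential moments of order `0` and `1` of the weight `g` are finite, the
antisymmetrised product of these moments at `a` and `-a` is nondecreasing in `a`. -/
lemma monotone_integral_mul_exp_sub {μ : Measure ℝ} [SFinite μ] {g : ℝ → ℝ}
    (hg : 0 ≤ᵐ[μ] g)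
    (h₀ : ∀ a : ℝ, Integrable (fun s => g s * Real.exp (a * s)) μ)
    (h₁ : ∀ a : ℝ, Integrable (fun s => s * g s * Real.exp (a * s)) μ) :
    Monotone fun a : ℝ =>
      (∫ s, s * g s * Real.exp (a * s) ∂μ) * (∫ s, g s * Real.exp (-(a * s)) ∂μ)
      - (∫ s, g s * Real.exp (a * s) ∂μ) * (∫ s, s * g s * Real.exp (-(a * s)) ∂μ) := by
  have h₀' (a : ℝ) : Integrable (fun s => g s * Real.exp (-(a * s))) μ := by
    simpa only [neg_mul] using h₀ (-a)
  have h₁' (a : ℝ) : Integrable (fun s => s * g s * Real.exp (-(a * s))) μ := by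
    simpa only [neg_mul] using h₁ (-a)
  have key (a : ℝ) (z : ℝ × ℝ) :
      z.1 * g z.1 * Real.exp (a * z.1) * (g z.2 * Real.exp (-(a * z.2)))
        - g z.1 * Real.exp (a * z.1) * (z.2 * g z.2 * Real.exp (-(a * z.2)))
      = g z.1 * g z.2 * ((z.1 - z.2) * Real.exp (a * (z.1 - z.2))) := by
    rw [mul_sub, sub_eq_add_neg (a * z.1), Real.exp_add]
    ring
  have hg₁ : ∀ᵐ z ∂μ.prod μ, 0 ≤ g z.1 := Measure.quasiMeasurePreserving_fst.ae hg
  have hg₂ : ∀ᵐ z ∂μ.prod μ, 0 ≤ g z.2 := Measure.quasiMeasurePreserving_snd.ae hg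
  intro a b hab
  simp only [← integral_prod_mul]
  rw [← integral_sub ((h₁ a).mul_prod (h₀' a)) ((h₀ a).mul_prod (h₁' a)),
    ← integral_sub ((h₁ b).mul_prod (h₀' b)) ((h₀ b).mul_prod (h₁' b))]
  refine integral_mono_ae (((h₁ a).mul_prod (h₀' a)).sub ((h₀ a).mul_prod (h₁' a)))
    (((h₁ b).mul_prod (h₀' b)).sub ((h₀ b).mul_prod (h₁' b))) ?_
  filter_upwards [hg₁, hg₂] with z hz₁ hz₂
  simp only [key]
  exact mul_le_mul_of_nonneg_left (monotone_mul_exp_mul _ hab) (mul_nonneg hz₁ hz₂)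

/-- The Jacobi weight `(1 - s) ^ (κ - 1) * (1 + s) ^ κ` is integrable on `[-1, 1]` for `κ > 0`. -/
lemma intervalIntegrable_one_sub_rpow_mul_one_add_rpow {κ : ℝ} (hκ : 0 < κ) :
    IntervalIntegrable (fun s : ℝ => (1 - s) ^ (κ - 1) * (1 + s) ^ κ) volume (-1) 1 := by
  have h : IntervalIntegrable (fun s : ℝ => (1 - s) ^ (κ - 1)) volume (-1) 1 := by
    have := (intervalIntegral.intervalIntegrable_rpow' (a := 2) (b := 0)
      (by linarith : -1 < κ - 1)).comp_sub_left 1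
    norm_num at this
    exact this
  refine h.mul_continuousOn (Continuous.continuousOn ?_)
  exact (continuous_const.add continuous_id).rpow_const fun _ => Or.inr hκ.le

/-- For `κ > 0` and `g(s) = (1−s)^{κ−1}(1+s)^{κ}` on `(−1,1)`, the function
`ψ(a) = (∫ s g(s) e^{as} ds)(∫ g(s) e^{−as} ds) − (∫ g(s) e^{as} ds)(∫ s g(s) e^{−as} ds)`
is nondecreasing on `ℝ`; in particular `ψ(a) ≥ 0` for `a ≥ 0` and `ψ(a) ≤ 0` for
`a ≤ 0` (all integrals over `(−1,1)`). -/
theorem stmt18 (κ : ℝ) (hκ : 0 < κ) :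
    Monotone (fun a : ℝ =>
      (∫ s in (-1 : ℝ)..(1 : ℝ),
          s * ((1 - s) ^ (κ - 1) * (1 + s) ^ κ) * Real.exp (a * s))
        * (∫ s in (-1 : ℝ)..(1 : ℝ),
          (1 - s) ^ (κ - 1) * (1 + s) ^ κ * Real.exp (-(a * s)))
      - (∫ s in (-1 : ℝ)..(1 : ℝ),
          (1 - s) ^ (κ - 1) * (1 + s) ^ κ * Real.exp (a * s))
        * (∫ s in (-1 : ℝ)..(1 : ℝ),
          s * ((1 - s) ^ (κ - 1) * (1 + s) ^ κ) * Real.exp (-(a * s))))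
    ∧ (∀ a : ℝ, 0 ≤ a →
      0 ≤ (∫ s in (-1 : ℝ)..(1 : ℝ),
            s * ((1 - s) ^ (κ - 1) * (1 + s) ^ κ) * Real.exp (a * s))
          * (∫ s in (-1 : ℝ)..(1 : ℝ),
            (1 - s) ^ (κ - 1) * (1 + s) ^ κ * Real.exp (-(a * s)))
        - (∫ s in (-1 : ℝ)..(1 : ℝ),
            (1 - s) ^ (κ - 1) * (1 + s) ^ κ * Real.exp (a * s))
          * (∫ s in (-1 : ℝ)..(1 : ℝ),
            s * ((1 - s) ^ (κ - 1) * (1 + s) ^ κ) * Real.exp (-(a * s))))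
    ∧ (∀ a : ℝ, a ≤ 0 →
      (∫ s in (-1 : ℝ)..(1 : ℝ),
            s * ((1 - s) ^ (κ - 1) * (1 + s) ^ κ) * Real.exp (a * s))
          * (∫ s in (-1 : ℝ)..(1 : ℝ),
            (1 - s) ^ (κ - 1) * (1 + s) ^ κ * Real.exp (-(a * s)))
        - (∫ s in (-1 : ℝ)..(1 : ℝ),
            (1 - s) ^ (κ - 1) * (1 + s) ^ κ * Real.exp (a * s))
          * (∫ s in (-1 : ℝ)..(1 : ℝ),
            s * ((1 - s) ^ (κ - 1) * (1 + s) ^ κ) * Real.exp (-(a * s))) ≤ 0) := by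
  have hle : (-1 : ℝ) ≤ 1 := by norm_num
  have hint := intervalIntegrable_one_sub_rpow_mul_one_add_rpow hκ
  have hmono := monotone_integral_mul_exp_sub (μ := volume.restrict (Set.Ioc (-1 : ℝ) 1))
    (g := fun s => (1 - s) ^ (κ - 1) * (1 + s) ^ κ)
    (by
      filter_upwards [ae_restrict_mem measurableSet_Ioc] with s hs
      exact mul_nonneg (Real.rpow_nonneg (by linarith [hs.2]) _)
        (Real.rpow_nonneg (by linarith [hs.1]) _))
    (fun a => (intervalIntegrable_iff_integrableOn_Ioc_of_le hle).1
      (hint.mul_continuousOn (by fun_prop)))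
    (fun a => (intervalIntegrable_iff_integrableOn_Ioc_of_le hle).1
      ((hint.continuousOn_mul continuousOn_id).mul_continuousOn (by fun_prop)))
  simp only [intervalIntegral.integral_of_le hle]
  refine ⟨hmono, fun a ha => ?_, fun a ha => ?_⟩
  · refine le_trans (le_of_eq ?_) (hmono ha)
    simp [mul_comm]
  · refine (hmono ha).trans (le_of_eq ?_)
    simp [mul_comm]
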